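/- Let V be a ℤ-graded F-vector space with V_(k) = 0 for k sufficiently small, equipped with linear maps Y(x)v = Σ_{k∈ℤ}Δ_k(v)x^{-k-1} and c : V → F satisfying all the axioms of a graded vertex coalgebra (left counit, cocreation, truncation, grading condition Δ_k(V_(r)) ⊆ (V⊗V)_(r+k+1)) except possibly the Jacobi identity. If the conclusions of right rationality, left rationality, cocommutativity and coassociativity all hold (i.e. for all v' ∈ (V^{⊗3})' and v ∈ V: ⟨v',(Id_V⊗Y(x_2))Y(x_1)v⟩ = ι_{12}f and ⟨v',(Y(x_0)⊗Id_V)Y(x_2)v⟩ = ι_{20}k for rational functions f, k with possible poles only at x_1=0, x_2=0, x_1=x_2, respectively x_0=0, x_2=0, x_0+x_2=0; ι_{12}^{-1}⟨v',(Id_V⊗Y(x_2))Y(x_1)v⟩ = ι_{21}^{-1}⟨v',(T⊗Id_V)(Id_V⊗Y(x_1))Y(x_2)v⟩; and ι_{12}^{-1}⟨v',(Id_V⊗Y(x_2))Y(x_1)v⟩ = (ι_{20}^{-1}⟨v',(Y(x_0)⊗Id_V)Y(x_2)v⟩)|_{x_0=x_1−x_2}), then the Jacobi identity holds, so (V, Y,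 c) is a graded vertex coalgebra. -/

import Mathlib

/- Common background for the formalization of "Vertex coalgebras, comodules,
cocommutativity and coassociativity" (K. Hubbard).

A vertex coalgebra `(V, Y, c)` is encoded by the family of coefficient maps
`Δ k : V →ₗ V ⊗ V` of the coproduct `Y(x)v = ∑ₖ Δ k v · x^(-k-1)` together with
the covacuum `c : V →ₗ F`.  All identities of formal series are encoded
coefficient-wise; in particular the Jacobi identity is encoded by its
(dual Borcherds) coefficient form. -/

noncomputable section

open scoped TensorProduct

variable (F : Type) [Field F] [CharZero F]

/-- The generalized binomial coefficient `(a choose i)` as an element of `F`. -/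
def gchoose (a : ℤ) (i : ℕ) : F :=
  (∏ j ∈ Finset.range i, ((a : F) - (j : F))) / (Nat.factorial i : F)

variable {V M : Type} [AddCommGroup V] [Module F V] [AddCommGroup M] [Module F M]

/-- `c ⊗ Id` composed with the canonical identification `F ⊗ M ≃ M`. -/
def cLeft (c : V →ₗ[F] F) : V ⊗[F] M →ₗ[F] M :=
  (TensorProduct.lid F M).toLinearMap ∘ₗ TensorProduct.map c LinearMap.id

/-- `Id ⊗ c` composed with the canonical identification `V ⊗ F ≃ V`. -/
def cRight (c : M →ₗ[F] F) : V ⊗[F] M →ₗ[F] V :=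
  (TensorProduct.rid F V).toLinearMap ∘ₗ TensorProduct.map LinearMap.id c

/-- The transposition `T ⊗ Id` of the first two tensor factors of `V ⊗ (V ⊗ M)`. -/
def Tfirst : V ⊗[F] (V ⊗[F] M) →ₗ[F] V ⊗[F] (V ⊗[F] M) :=
  (TensorProduct.assoc F V V M).toLinearMap ∘ₗ
    TensorProduct.map (TensorProduct.comm F V V).toLinearMap LinearMap.id ∘ₗ
    (TensorProduct.assoc F V V M).symm.toLinearMap

/-- The coefficient of `x₁^(-m-1) x₂^(-n-1)` in `(Id ⊗ Y(x₂)) Y(x₁)`. -/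
def comp12 (ΔM : ℤ → M →ₗ[F] V ⊗[F] M) (m n : ℤ) : M →ₗ[F] V ⊗[F] (V ⊗[F] M) :=
  TensorProduct.map LinearMap.id (ΔM n) ∘ₗ ΔM m

/-- The coefficient of `x₀^(-m-1) x₂^(-n-1)` in `(Y(x₀) ⊗ Id) Y(x₂)`. -/
def compR (ΔV : ℤ → V →ₗ[F] V ⊗[F] V) (ΔM : ℤ → M →ₗ[F] V ⊗[F] M) (m n : ℤ) :
    M →ₗ[F] V ⊗[F] (V ⊗[F] M) :=
  (TensorProduct.assoc F V V M).toLinearMap ∘ₗ TensorProduct.map (ΔV m) LinearMap.id ∘ₗ ΔM n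

/-- The coefficient form of the (comodule) Jacobi identity of a vertex coalgebra,
obtained by extracting the coefficient of `x₀^(-a-1) x₁^(-b-1) x₂^(-c-1)`. -/
def JacobiId (ΔV : ℤ → V →ₗ[F] V ⊗[F] V) (ΔM : ℤ → M →ₗ[F] V ⊗[F] M) : Prop :=
  ∀ (a b c : ℤ) (w : M),
    (∑ᶠ i : ℕ, ((-1 : F) ^ i * gchoose F a i) •
        (comp12 F ΔM (a + b - i) (c + i) w -
          (-1 : F) ^ a • Tfirst F (comp12 F ΔM (a + c - i) (b + i) w))) =
      ∑ᶠ i : ℕ, gchoose F b i • compR F ΔV ΔM (a + i) (b + c - i) w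

/-- The axioms of a vertex coalgebra except the Jacobi identity: left counit,
cocreation and truncation, in coefficient form. -/
def IsVertexCoalgSansJacobi (Δ : ℤ → V →ₗ[F] V ⊗[F] V) (c : V →ₗ[F] F) : Prop :=
  (∀ v : V, cLeft F c (Δ (-1) v) = v) ∧
  (∀ k : ℤ, k ≠ -1 → ∀ v : V, cLeft F c (Δ k v) = 0) ∧
  (∀ v : V, cRight F c (Δ (-1) v) = v) ∧
  (∀ k : ℤ, 0 ≤ k → ∀ v : V, cRight F c (Δ k v) = 0) ∧
  (∀ v : V, ∃ N : ℤ, ∀ k : ℤ, k < N → Δ k v = 0)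

/-- The axioms of a vertex coalgebra. -/
def IsVertexCoalg (Δ : ℤ → V →ₗ[F] V ⊗[F] V) (c : V →ₗ[F] F) : Prop :=
  IsVertexCoalgSansJacobi F Δ c ∧ JacobiId F Δ Δ

/-- The weight-`m` component of `V ⊗ V` for a graded space `V`. -/
def grT2 (gr : ℤ → Submodule F V) (m : ℤ) : Submodule F (V ⊗[F] V) :=
  ⨆ p : ℤ, LinearMap.range (TensorProduct.map (gr p).subtype (gr (m - p)).subtype)

/-- The weight-`m` component of `V ⊗ (V ⊗ V)` for a graded space `V`. -/
def grT3 (gr : ℤ → Submodule F V) (m : ℤ) : Submodule F (V ⊗[F] (V ⊗[F] V)) :=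
  ⨆ p : ℤ × ℤ, LinearMap.range (TensorProduct.map (gr p.1).subtype
    (TensorProduct.map (gr p.2).subtype (gr (m - p.1 - p.2)).subtype))

/-- The grading axioms of a graded vertex coalgebra: `V = ⊕ₖ V₍ₖ₎` internally,
`V₍ₖ₎ = 0` for `k` sufficiently small, and `Δ k` raises weight by `k + 1`. -/
def IsGradedVC (Δ : ℤ → V →ₗ[F] V ⊗[F] V) (gr : ℤ → Submodule F V) : Prop :=
  DirectSum.IsInternal gr ∧ (∃ N : ℤ, ∀ k : ℤ, k < N → gr k = ⊥) ∧
  (∀ r k : ℤ, ∀ v ∈ gr r, Δ k v ∈ grT2 F gr (r + k + 1))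

/-- `f` belongs to the graded dual `(V^{⊗3})'`: it vanishes on all but finitely
many homogeneous components of `V ⊗ V ⊗ V`. -/
def GradedDual3 (gr : ℤ → Submodule F V) (f : V ⊗[F] (V ⊗[F] V) →ₗ[F] F) : Prop :=
  ∃ s : Finset ℤ, ∀ m : ℤ, m ∉ s → ∀ u ∈ grT3 F gr m, f u = 0

/-- The weight-`q` component of `V ⊗ M` for `V` a `ℤ`-graded space and
`M` a `ℚ`-graded space. -/
def grVM (gr : ℤ → Submodule F V) (grM : ℚ → Submodule F M) (q : ℚ) :
    Submodule F (V ⊗[F] M) :=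
  ⨆ p : ℤ, LinearMap.range (TensorProduct.map (gr p).subtype (grM (q - p)).subtype)

/-- The weight-`q` component of `V ⊗ (V ⊗ M)`. -/
def grVVM (gr : ℤ → Submodule F V) (grM : ℚ → Submodule F M) (q : ℚ) :
    Submodule F (V ⊗[F] (V ⊗[F] M)) :=
  ⨆ p : ℤ × ℤ, LinearMap.range (TensorProduct.map (gr p.1).subtype
    (TensorProduct.map (gr p.2).subtype (grM (q - p.1 - p.2)).subtype))

/-- `f` belongs to the graded dual `(V ⊗ V ⊗ M)'`. -/
def GradedDualVVM (gr : ℤ → Submodule F V) (grM : ℚ → Submodule F M)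
    (f : V ⊗[F] (V ⊗[F] M) →ₗ[F] F) : Prop :=
  ∃ s : Finset ℚ, ∀ q : ℚ, q ∉ s → ∀ u ∈ grVVM F gr grM q, f u = 0

/-- The axioms of a comodule over a graded vertex coalgebra, except the Jacobi
identity: left counit, truncation, internal `ℚ`-grading bounded below, and the
grading condition on the comodule coproduct. -/
def IsComoduleSansJacobi (c : V →ₗ[F] F) (ΔM : ℤ → M →ₗ[F] V ⊗[F] M)
    (gr : ℤ → Submodule F V) (grM : ℚ → Submodule F M) : Prop :=
  (∀ w : M, cLeft F c (ΔM (-1) w) = w) ∧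
  (∀ k : ℤ, k ≠ -1 → ∀ w : M, cLeft F c (ΔM k w) = 0) ∧
  (∀ w : M, ∃ N : ℤ, ∀ k : ℤ, k < N → ΔM k w = 0) ∧
  DirectSum.IsInternal grM ∧ (∃ N : ℚ, ∀ q : ℚ, q < N → grM q = ⊥) ∧
  (∀ (j : ℚ) (k : ℤ), ∀ w ∈ grM j, ΔM k w ∈ grVM F gr grM (j + k + 1))

/-- Weak cocommutativity with exponent `k`, paired against `f`, coefficient-wise:
the coefficient of `x₁^(-b-1) x₂^(-c-1)` in
`(x₁-x₂)^k ⟨f, (Id ⊗ Y(x₂))Y(x₁)w - (T ⊗ Id)(Id ⊗ Y(x₁))Y(x₂)w⟩` vanishes. -/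
def WeakCocom (ΔM : ℤ → M →ₗ[F] V ⊗[F] M) (f : V ⊗[F] (V ⊗[F] M) →ₗ[F] F)
    (k : ℕ) : Prop :=
  ∀ (w : M) (b c : ℤ),
    ∑ j ∈ Finset.range (k + 1), ((-1 : F) ^ j * (k.choose j : F)) *
      (f (comp12 F ΔM (b + k - j) (c + j) w) -
        f (Tfirst F (comp12 F ΔM (c + j) (b + k - j) w))) = 0

/-- Weak coassociativity with exponent `k`, paired against `f`, coefficient-wise:
the coefficient of `x₀^(-a-1) x₂^(-c-1)` in
`(x₀+x₂)^k ⟨f, (Y(x₀) ⊗ Id)Y(x₂)w - (Id ⊗ Y(x₂))Y(x₀+x₂)w⟩` vanishes,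
`Y(x₀+x₂)` being expanded in nonnegative integral powers of `x₂`. -/
def WeakCoassoc (ΔV : ℤ → V →ₗ[F] V ⊗[F] V) (ΔM : ℤ → M →ₗ[F] V ⊗[F] M)
    (f : V ⊗[F] (V ⊗[F] M) →ₗ[F] F) (k : ℕ) : Prop :=
  ∀ (w : M) (a c : ℤ),
    ∑ j ∈ Finset.range (k + 1), (k.choose j : F) *
      (f (compR F ΔV ΔM (a + k - j) (c + j) w) -
        ∑ᶠ i : ℕ, ((-1 : F) ^ i * gchoose F (a + k - j) i) *
          f (comp12 F ΔM (a + k - j - i) (c + j + i) w)) = 0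

/-- The coefficient function of `x^r y^s (x + ε y)^t · A`, where `A : ℤ → ℤ → F`
is the coefficient function of a formal series (`A m n` is the coefficient of
`x^m y^n`). -/
def mulPoly (r s t : ℕ) (ε : F) (A : ℤ → ℤ → F) (m n : ℤ) : F :=
  ∑ j ∈ Finset.range (t + 1), (t.choose j : F) * ε ^ j *
    A (m - (r : ℤ) - ((t - j : ℕ) : ℤ)) (n - (s : ℤ) - (j : ℤ))

/-- `g` is the coefficient function of a polynomial in two variables. -/
def IsPolyCoeff (g : ℤ → ℤ → F) : Prop :=
  {p : ℤ × ℤ | g p.1 p.2 ≠ 0}.Finite ∧ ∀ m n : ℤ, m < 0 ∨ n < 0 → g m n = 0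

/-- The coefficient function of the polynomial `h(x₁ - x₂, x₂)` in the
variables `x₁, x₂`, given the coefficient function of `h = h(x₀, x₂)`. -/
def substC (h : ℤ → ℤ → F) (m n : ℤ) : F :=
  ∑ᶠ j : ℕ, ((-1 : F) ^ j * gchoose F (m + j) j) * h (m + j) (n - j)

/-- The coefficient form of the Jacobi identity of a vertex algebra (the
Borcherds identity). -/
def VAJacobi (mul : ℤ → V →ₗ[F] V →ₗ[F] V) : Prop :=
  ∀ (a b c : ℤ) (u v w : V),
    (∑ᶠ i : ℕ, ((-1 : F) ^ i * gchoose F a i) •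
        (mul (a + b - i) u (mul (c + i) v w) -
          (-1 : F) ^ a • mul (a + c - i) v (mul (b + i) u w))) =
      ∑ᶠ i : ℕ, gchoose F b i • mul (b + c - i) (mul (a + i) u v) w

/-- The axioms of a vertex algebra: truncation, vacuum, creation and the Jacobi
identity, in coefficient form (`mul n u v` is `u_n v`). -/
def IsVA (mul : ℤ → V →ₗ[F] V →ₗ[F] V) (one : V) : Prop :=
  (∀ u v : V, ∃ N : ℤ, ∀ n : ℤ, N < n → mul n u v = 0) ∧
  (∀ v : V, mul (-1) one v = v) ∧
  (∀ n : ℤ, n ≠ -1 → ∀ v : V, mul n one v = 0) ∧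
  (∀ v : V, mul (-1) v one = v) ∧
  (∀ n : ℤ, 0 ≤ n → ∀ v : V, mul n v one = 0) ∧
  VAJacobi F mul

/-- The graded dual `V' = ⊕ₖ V₍ₖ₎*`, realized as the submodule of the full dual
consisting of functionals vanishing on all but finitely many components. -/
def gradedDual (gr : ℤ → Submodule F V) : Submodule F (Module.Dual F V) where
  carrier := {φ | ∃ s : Finset ℤ, ∀ k ∉ s, ∀ u ∈ gr k, φ u = 0}
  zero_mem' := ⟨∅, by intro k _ u _; simp⟩
  add_mem' := by
    rintro a b ⟨s, hs⟩ ⟨t, ht⟩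
    refine ⟨s ∪ t, ?_⟩
    intro k hk u hu
    simp only [Finset.mem_union, not_or] at hk
    simp [LinearMap.add_apply, hs k hk.1 u hu, ht k hk.2 u hu]
  smul_mem' := by
    rintro r a ⟨s, hs⟩
    refine ⟨s, ?_⟩
    intro k hk u hu
    simp [LinearMap.smul_apply, hs k hk u hu]

/-- The weight-`k` component `V₍ₖ₎* ⊆ V'` of the graded dual: functionals
vanishing on every component of weight other than `k`. -/
def gradedDualPiece (gr : ℤ → Submodule F V) (k : ℤ) :
    Submodule F ↥(gradedDual F gr) where
  carrier := {φ | ∀ j : ℤ, j ≠ k → ∀ u ∈ gr j, (φ : Module.Dual F V) u = 0}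
  zero_mem' := by intro j _ u _; simp
  add_mem' := by
    intro a b ha hb j hj u hu
    simp [ha j hj u hu, hb j hj u hu]
  smul_mem' := by
    intro r a ha j hj u hu
    simp [ha j hj u hu]

/-- The natural pairing of `V' ⊗ V'` with `V ⊗ V`. -/
def pairVV (gr : ℤ → Submodule F V) :
    ↥(gradedDual F gr) ⊗[F] ↥(gradedDual F gr) →ₗ[F] Module.Dual F (V ⊗[F] V) :=
  TensorProduct.dualDistrib F V V ∘ₗ
    TensorProduct.map (gradedDual F gr).subtype (gradedDual F gr).subtype

/-- The covacuum map on the graded dual: evaluation at the vacuum. -/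
def covac (gr : ℤ → Submodule F V) (one : V) : ↥(gradedDual F gr) →ₗ[F] F :=
  LinearMap.applyₗ one ∘ₗ (gradedDual F gr).subtype

/-- A bilinear form `B` on `V` extended componentwise to `V ⊗ V`. -/
def formT2 (B : V →ₗ[F] V →ₗ[F] F) : V ⊗[F] V →ₗ[F] Module.Dual F (V ⊗[F] V) :=
  TensorProduct.dualDistrib F V V ∘ₗ TensorProduct.map B B

set_option linter.unusedSectionVars false

theorem gchoose_zero (a : ℤ) : gchoose F a 0 = 1 := by
  simp [gchoose]

theorem gchoose_succ_succ (a : ℤ) (i : ℕ) :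
    gchoose F (a + 1) (i + 1) = gchoose F a (i + 1) + gchoose F a i := by
  have h : ∏ j ∈ Finset.range i, (((a + 1 : ℤ) : F) - ((j + 1 : ℕ) : F)) =
      ∏ j ∈ Finset.range i, ((a : F) - (j : F)) :=
    Finset.prod_congr rfl fun j _ => by push_cast; ring
  have h₁ : (Nat.factorial i : F) ≠ 0 := by exact_mod_cast Nat.factorial_ne_zero i
  have h₂ : (i : F) + 1 ≠ 0 := by exact_mod_cast Nat.succ_ne_zero i
  simp only [gchoose]
  rw [Finset.prod_range_succ', h, Finset.prod_range_succ, Nat.factorial_succ]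
  push_cast
  field_simp
  ring

theorem gchoose_natCast (t i : ℕ) : gchoose F (t : ℤ) i = (t.choose i : F) := by
  induction t generalizing i with
  | zero =>
    cases i with
    | zero => simp [gchoose_zero]
    | succ i => simp [gchoose, Finset.prod_range_succ']
  | succ t ih =>
    cases i with
    | zero => simp [gchoose_zero]
    | succ i =>
      rw [Nat.cast_succ, gchoose_succ_succ, ih, ih, Nat.choose_succ_succ]
      push_cast
      ring

/-- The residue of `x^b y^c (x + ε y)^a · X`, with `(x + ε y)^a` expanded in nonnegative powers
of `y`, where `X m n` is the coefficient of `x^(-m-1) y^(-n-1)`. -/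
def binomResidue (ε : F) (X : ℤ → ℤ → F) (a b c : ℤ) : F :=
  ∑ᶠ i : ℕ, (ε ^ i * gchoose F a i) * X (a + b - i) (c + i)

section binomResidue

variable {F}
variable {ε : F} {X : ℤ → ℤ → F}

theorem binomResidue_eq_sum {K : ℤ} (hX : ∀ m n, K ≤ n → X m n = 0) (a b c : ℤ) {M : ℕ}
    (hM : K ≤ c + M) :
    binomResidue F ε X a b c =
      ∑ i ∈ Finset.range M, (ε ^ i * gchoose F a i) * X (a + b - i) (c + i) := by
  refine finsum_eq_sum_of_support_subset _ fun i hi => ?_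
  by_contra h
  simp only [Finset.coe_range, Set.mem_Iio, not_lt] at h
  exact hi (by dsimp only; rw [hX _ _ (by omega), mul_zero])

theorem binomResidue_eq_zero {K : ℤ} (hX : ∀ m n, K ≤ n → X m n = 0) (a b c : ℤ)
    (hc : K ≤ c) : binomResidue F ε X a b c = 0 := by
  rw [binomResidue_eq_sum hX a b c (M := 0) (by simpa using hc)]
  simp

theorem binomResidue_succ {K : ℤ} (hX : ∀ m n, K ≤ n → X m n = 0) (a b c : ℤ) :
    binomResidue F ε X (a + 1) b c =
      binomResidue F ε X a (b + 1) c + ε * binomResidue F ε X a b (c + 1) := by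
  have hM : K ≤ c + (K - c).toNat := by have := Int.self_le_toNat (K - c); omega
  generalize (K - c).toNat = M at hM
  rw [binomResidue_eq_sum hX (a + 1) b c (M := M + 1) (by push_cast; omega),
    binomResidue_eq_sum hX a (b + 1) c (M := M + 1) (by push_cast; omega),
    binomResidue_eq_sum hX a b (c + 1) (M := M) (by omega),
    Finset.sum_range_succ', Finset.sum_range_succ', Finset.mul_sum]
  rw [add_right_comm _ _ (∑ i ∈ Finset.range M, _), ← Finset.sum_add_distrib]
  congr 1
  · refine Finset.sum_congr rfl fun i _ => ?_
    rw [gchoose_succ_succ,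
      show a + 1 + b - ((i + 1 : ℕ) : ℤ) = a + b - i by push_cast; ring,
      show a + (b + 1) - ((i + 1 : ℕ) : ℤ) = a + b - i by push_cast; ring,
      show c + ((i + 1 : ℕ) : ℤ) = c + 1 + i by push_cast; ring]
    ring
  · rw [gchoose_zero, gchoose_zero, show a + 1 + b = a + (b + 1) by ring]

theorem binomResidue_natCast (t : ℕ) (b c : ℤ) :
    binomResidue F ε X t b c =
      ∑ i ∈ Finset.range (t + 1), ((t.choose i : F) * ε ^ i) * X (t + b - i) (c + i) := by
  simp only [binomResidue, gchoose_natCast]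
  rw [finsum_eq_sum_of_support_subset (s := Finset.range (t + 1))]
  · exact Finset.sum_congr rfl fun i _ => by ring
  · intro i hi
    by_contra h
    simp only [Finset.coe_range, Set.mem_Iio, not_lt] at h
    exact hi (by simp [Nat.choose_eq_zero_of_lt h])

theorem mulPoly_eq_binomResidue (r s t : ℕ) (m n : ℤ) :
    mulPoly F r s t ε (fun m' n' => X (-m' - 1) (-n' - 1)) m n =
      binomResidue F ε X t (r - m - 1) (s - n - 1) := by
  rw [binomResidue_natCast, mulPoly]
  refine Finset.sum_congr rfl fun i hi => ?_
  have := Finset.mem_range.1 hi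
  congr 2 <;> omega

/-- Reversing the roles of the two variables in `(x + ε y)^t` for a nonnegative exponent. -/
theorem binomResidue_swap (hε : ε * ε = 1) (t : ℕ) (b c : ℤ) :
    binomResidue F ε X t b c = ε ^ t * binomResidue F ε (fun m n => X n m) t c b := by
  rw [binomResidue_natCast, binomResidue_natCast, ← Finset.sum_range_reflect, Finset.mul_sum]
  refine Finset.sum_congr rfl fun i hi => ?_
  have hi' : i ≤ t := Nat.lt_succ_iff.1 (Finset.mem_range.1 hi)
  have e : t + 1 - 1 - i = t - i := by omega
  have h : ε ^ t * ε ^ i = ε ^ (t - i) := by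
    conv_lhs => rw [← Nat.sub_add_cancel hi', pow_add, mul_assoc, ← mul_pow, hε, one_pow, mul_one]
  rw [e, Nat.choose_symm hi', ← h,
    show (t : ℤ) + b - ((t - i : ℕ) : ℤ) = b + i by omega,
    show c + ((t - i : ℕ) : ℤ) = t + c - i by omega]
  ring

end binomResidue

/-- The recurrence satisfied by the residues of `x₀^a x₁^b x₂^c` times a fixed series, expressing
`x₀ = x₁ - x₂`. -/
def BorcherdsRec (G : ℤ → ℤ → ℤ → F) : Prop :=
  ∀ a b c : ℤ, G (a + 1) b c = G a (b + 1) c - G a b (c + 1)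

section BorcherdsRec

variable {F}
variable {G G' : ℤ → ℤ → ℤ → F}

theorem BorcherdsRec.sub (hG : BorcherdsRec F G) (hG' : BorcherdsRec F G') :
    BorcherdsRec F fun a b c => G a b c - G' a b c := by
  intro a b c
  dsimp only
  rw [hG, hG']
  ring

theorem BorcherdsRec.eq_zero_of_le_fst (hG : BorcherdsRec F G) {a₀ : ℤ}
    (h : ∀ b c, G a₀ b c = 0) {a : ℤ} (ha : a₀ ≤ a) (b c : ℤ) : G a b c = 0 := by
  induction a, ha using Int.leInduction generalizing b c with
  | base => exact h b c
  | succ a _ ih => rw [hG, ih, ih, sub_zero]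

theorem BorcherdsRec.eq_zero_of_le_snd (hG : BorcherdsRec F G) {b₀ : ℤ}
    (h : ∀ a c, G a b₀ c = 0) {b : ℤ} (hb : b₀ ≤ b) (a c : ℤ) : G a b c = 0 := by
  induction b, hb using Int.leInduction generalizing a c with
  | base => exact h a c
  | succ b _ ih => simpa [ih] using (hG a b c).symm

/-- A solution vanishing for one value of `a`, and for large `c`, vanishes. -/
theorem BorcherdsRec.eq_zero_of_fst_of_large (hG : BorcherdsRec F G) {a₀ N : ℤ}
    (h : ∀ b c, G a₀ b c = 0) (hN : ∀ a b c, N ≤ c → G a b c = 0) (a b c : ℤ) :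
    G a b c = 0 := by
  rcases le_total a₀ a with ha | ha
  · exact hG.eq_zero_of_le_fst h ha b c
  · induction a, ha using Int.leInductionDown generalizing b c with
    | base => exact h b c
    | pred a _ ih =>
      have step : ∀ b c, G (a - 1) b c = G (a - 1) (b - 1) (c + 1) := by
        intro b c
        have := hG (a - 1) (b - 1) c
        rw [sub_add_cancel, sub_add_cancel, ih] at this
        exact (sub_eq_zero.1 this.symm)
      have iter : ∀ (i : ℕ) b c, G (a - 1) b c = G (a - 1) (b - i) (c + i) := by
        intro i
        induction i with
        | zero => simp
        | succ i ihi =>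
          intro b c
          rw [ihi, step]
          congr 1 <;> push_cast <;> ring
      rw [iter (N - c).toNat]
      exact hN _ _ _ (by have := Int.self_le_toNat (N - c); omega)

/-- A solution vanishing for large `a`, and for large `b`, vanishes. -/
theorem BorcherdsRec.eq_zero_of_large (hG : BorcherdsRec F G) {K L : ℤ}
    (hK : ∀ a b c, K ≤ a → G a b c = 0) (hL : ∀ a b c, L ≤ b → G a b c = 0) (a b c : ℤ) :
    G a b c = 0 := by
  obtain ⟨n, hn⟩ : ∃ n : ℕ, (K - a).toNat + (L - b).toNat = n := ⟨_, rfl⟩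
  induction n generalizing a b c with
  | zero => exact hK _ _ _ (by omega)
  | succ n ih =>
    by_cases ha : K ≤ a
    · exact hK _ _ _ ha
    by_cases hb : L ≤ b
    · exact hL _ _ _ hb
    have := hG a b (c - 1)
    rw [ih (a + 1) b _ (by omega), ih a (b + 1) _ (by omega), sub_add_cancel] at this
    simpa using this.symm

end BorcherdsRec

section Monomials

variable {F}

/-- The coefficients of the constant series `1`. -/
def unitCoeff (m n : ℤ) : F := if m = -1 ∧ n = -1 then 1 else 0

theorem unitCoeff_eq_zero (m n : ℤ) (h : 0 ≤ n) : (unitCoeff m n : F) = 0 :=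
  if_neg (by omega)

theorem binomResidue_unitCoeff_zero (a c : ℤ) :
    binomResidue F (-1) unitCoeff a 0 c = unitCoeff a c := by
  rw [binomResidue, finsum_eq_single _ 0]
  · simp [gchoose_zero]
  · intro i hi
    by_cases h : a + 0 - i = -1 ∧ c + i = -1
    · obtain ⟨t, rfl⟩ : ∃ t : ℕ, a = t := ⟨a.toNat, by omega⟩
      rw [gchoose_natCast, Nat.choose_eq_zero_of_lt (by omega)]
      simp
    · rw [unitCoeff, if_neg h, mul_zero]

/-- The residue of `x₀^a x₁^b x₂^c h(x₀, x₂) / (x₀^r x₂^s x₁^t)` at `x₀ = x₁ - x₂`, expanded in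
nonnegative powers of `x₂`, for a polynomial `h` supported on `S`. -/
def rationalResidue (h : ℤ → ℤ → F) (S : Finset (ℤ × ℤ)) (r s t : ℕ) (a b c : ℤ) : F :=
  ∑ p ∈ S, h p.1 p.2 * binomResidue F (-1) unitCoeff (a - r + p.1) (b - t) (c - s + p.2)

theorem borcherdsRec_rationalResidue (h : ℤ → ℤ → F) (S : Finset (ℤ × ℤ)) (r s t : ℕ) :
    BorcherdsRec F (rationalResidue h S r s t) := by
  intro a b c
  simp only [rationalResidue]
  rw [← Finset.sum_sub_distrib]
  refine Finset.sum_congr rfl fun p _ => ?_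
  rw [show a + 1 - r + p.1 = a - r + p.1 + 1 by ring, binomResidue_succ unitCoeff_eq_zero,
    show b + 1 - t = b - t + 1 by ring, show c + 1 - s + p.2 = c - s + p.2 + 1 by ring]
  ring

variable {h : ℤ → ℤ → F} {S : Finset (ℤ × ℤ)}

theorem rationalResidue_eq_zero (hh : ∀ m n, m < 0 ∨ n < 0 → h m n = 0) (r s t : ℕ)
    (a b c : ℤ) (hc : s ≤ c) : rationalResidue h S r s t a b c = 0 := by
  refine Finset.sum_eq_zero fun p _ => ?_
  by_cases hp : p.2 < 0
  · rw [hh _ _ (Or.inr hp), zero_mul]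
  · rw [binomResidue_eq_zero unitCoeff_eq_zero _ _ _ (by omega), mul_zero]

theorem sum_mul_ite_eq (hS : ∀ m n, h m n ≠ 0 → (m, n) ∈ S) (m n : ℤ) :
    ∑ p ∈ S, h p.1 p.2 * (if p.1 = m ∧ p.2 = n then (1 : F) else 0) = h m n := by
  rw [Finset.sum_eq_single (m, n)]
  · simp
  · rintro ⟨x, y⟩ _ hp
    rw [if_neg (by simpa using hp), mul_zero]
  · intro hm
    simpa using not_imp_comm.1 (hS m n) hm

theorem rationalResidue_snd (hS : ∀ m n, h m n ≠ 0 → (m, n) ∈ S) (r s t : ℕ) (a c : ℤ) :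
    rationalResidue h S r s t a t c = h (r - a - 1) (s - c - 1) := by
  rw [rationalResidue, ← sum_mul_ite_eq hS]
  refine Finset.sum_congr rfl fun p _ => ?_
  rw [sub_self, binomResidue_unitCoeff_zero, unitCoeff]
  congr 2
  exact propext (by omega)

theorem rationalResidue_fst (hh : ∀ m n, m < 0 ∨ n < 0 → h m n = 0)
    (hS : ∀ m n, h m n ≠ 0 → (m, n) ∈ S) (r s t : ℕ) (b c : ℤ) :
    rationalResidue h S r s t r b c = substC F h (t - b - 1) (s - c - 1) := by
  have hfin : ∀ f : ℕ → F, (∀ j : ℕ, s - c - 1 < j → f j = 0) →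
      ∑ᶠ j, f j = ∑ j ∈ Finset.range (s - c).toNat, f j := by
    intro f hf
    refine finsum_eq_sum_of_support_subset _ fun i hi => ?_
    by_contra hlt
    simp only [Finset.coe_range, Set.mem_Iio, not_lt] at hlt
    exact hi (hf i (by omega))
  rw [substC, hfin _ fun j hj => by rw [hh _ _ (Or.inr (by omega)), mul_zero]]
  calc rationalResidue h S r s t r b c
      = ∑ p ∈ S, ∑ j ∈ Finset.range (s - c).toNat,
          ((-1 : F) ^ j * gchoose F (t - b - 1 + j) j) *
            (h p.1 p.2 * if p.1 = t - b - 1 + j ∧ p.2 = s - c - 1 - j then 1 else 0) := by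
        refine Finset.sum_congr rfl fun p _ => ?_
        by_cases hp : p.2 < 0
        · simp [hh _ _ (Or.inr hp)]
        rw [binomResidue, hfin, Finset.mul_sum]
        · refine Finset.sum_congr rfl fun j _ => ?_
          by_cases hj : p.1 = t - b - 1 + j ∧ p.2 = s - c - 1 - j
          · rw [if_pos hj, unitCoeff, if_pos (by omega), sub_self, zero_add, ← hj.1]
            ring
          · rw [if_neg hj, unitCoeff, if_neg (by omega)]
            ring
        · intro j hj
          rw [unitCoeff, if_neg (by omega), mul_zero]
    _ = _ := by
        rw [Finset.sum_comm]
        refine Finset.sum_congr rfl fun j _ => ?_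
        rw [← Finset.mul_sum, sum_mul_ite_eq hS]

end Monomials

/-- The three-term residue identity behind the Jacobi identity: `X`, `Y`, `Z` are coefficients of
expansions of a single rational function in the domains `ι₁₂`, `ι₂₁`, `ι₂₀`. -/
theorem binomResidue_sub_eq {X Y Z : ℤ → ℤ → F} {K₁ K₂ K₃ : ℤ}
    (hX : ∀ m n, K₁ ≤ n → X m n = 0) (hY : ∀ m n, K₂ ≤ n → Y m n = 0)
    (hZ : ∀ m n, K₃ ≤ m → Z m n = 0) {r s t : ℕ}
    (hXY : ∀ m n : ℤ, mulPoly F r s t (-1) (fun m' n' => X (-m' - 1) (-n' - 1)) m n =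
      mulPoly F r s t (-1) (fun m' n' => Y (-n' - 1) (-m' - 1)) m n)
    {h : ℤ → ℤ → F} (hh : IsPolyCoeff F h) {r' s' t' : ℕ}
    (hZh : ∀ m n : ℤ, mulPoly F r' s' t' 1 (fun m' n' => Z (-m' - 1) (-n' - 1)) m n = h m n)
    (hXh : ∀ m n : ℤ, mulPoly F t' s' r' (-1) (fun m' n' => X (-m' - 1) (-n' - 1)) m n =
      substC F h m n) (a b c : ℤ) :
    binomResidue F (-1) X a b c - (-1) ^ a * binomResidue F (-1) Y a c b =
      binomResidue F 1 (fun m n => Z n m) b c a := by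
  have hZ' : ∀ m n, K₃ ≤ n → (fun m n => Z n m) m n = 0 := fun m n hn => hZ n m hn
  have recX : BorcherdsRec F (binomResidue F (-1) X) := fun a b c => by
    rw [binomResidue_succ hX]; ring
  have recY : BorcherdsRec F fun a b c => (-1) ^ a * binomResidue F (-1) Y a c b :=
    fun a b c => by
      dsimp only
      rw [binomResidue_succ hY, zpow_add_one₀ (by simp)]
      ring
  have recZ : BorcherdsRec F fun a b c => binomResidue F 1 (fun m n => Z n m) b c a :=
    fun a b c => by
      dsimp only
      rw [binomResidue_succ hZ']
      ring
  have commute : ∀ a b c, (t : ℤ) ≤ a →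
      binomResidue F (-1) X a b c - (-1) ^ a * binomResidue F (-1) Y a c b = 0 := by
    refine fun a b c ha => (recX.sub recY).eq_zero_of_le_fst (a₀ := t) (fun b c => ?_) ha b c
    have e := hXY (r - b - 1) (s - c - 1)
    rw [mulPoly_eq_binomResidue,
      mulPoly_eq_binomResidue (X := fun m n => Y n m),
      show (r : ℤ) - (r - b - 1) - 1 = b by ring, show (s : ℤ) - (s - c - 1) - 1 = c by ring,
      binomResidue_swap (X := fun m n => Y n m) (by ring)] at e
    rw [e, zpow_natCast, sub_self]
  have valX : ∀ a c : ℤ, binomResidue F (-1) X a t' c = h (r' - a - 1) (s' - c - 1) := by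
    intro a c
    have hS : ∀ m n, h m n ≠ 0 → (m, n) ∈ hh.1.toFinset := fun m n hmn => by simpa using hmn
    rw [← rationalResidue_snd hS r' s' t' a c, ← sub_eq_zero]
    refine (recX.sub (borcherdsRec_rationalResidue h _ r' s' t')).eq_zero_of_fst_of_large
      (a₀ := r') (N := max K₁ s') (fun b c => ?_) (fun a b c hc => ?_) a t' c
    · have e := hXh (t' - b - 1) (s' - c - 1)
      rw [mulPoly_eq_binomResidue, show (t' : ℤ) - (t' - b - 1) - 1 = b by ring,
        show (s' : ℤ) - (s' - c - 1) - 1 = c by ring] at e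
      rw [e, rationalResidue_fst hh.2 hS, sub_self]
    · rw [binomResidue_eq_zero hX _ _ _ (le_trans (le_max_left _ _) hc),
        rationalResidue_eq_zero hh.2 _ _ _ _ _ _ (le_trans (le_max_right _ _) hc), sub_self]
  have valZ : ∀ a c : ℤ, binomResidue F 1 (fun m n => Z n m) t' c a =
      h (r' - a - 1) (s' - c - 1) := by
    intro a c
    rw [← hZh, mulPoly_eq_binomResidue, binomResidue_swap (by ring), one_pow, one_mul]
    congr 1 <;> ring
  have assoc : ∀ a b c, (t' : ℤ) ≤ b →
      binomResidue F (-1) X a b c - binomResidue F 1 (fun m n => Z n m) b c a = 0 :=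
    fun a b c hb => (recX.sub recZ).eq_zero_of_le_snd (b₀ := t')
      (fun a c => by rw [valX, valZ, sub_self]) hb a c
  rw [← sub_eq_zero]
  refine ((recX.sub recY).sub recZ).eq_zero_of_large (K := max t K₃) (L := max t' K₂)
    (fun a b c ha => ?_) (fun a b c hb => ?_) a b c
  · rw [commute a b c (le_trans (le_max_left _ _) ha),
      binomResidue_eq_zero hZ' _ _ _ (le_trans (le_max_right _ _) ha), sub_self]
  · rw [binomResidue_eq_zero hY _ _ _ (le_trans (le_max_right _ _) hb), mul_zero, sub_zero,
      assoc a b c (le_trans (le_max_left _ _) hb)]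

section GradedDual

variable {F}
variable {gr : ℤ → Submodule F V}

theorem Tfirst_mem_grT3 {m : ℤ} {u : V ⊗[F] (V ⊗[F] V)} (hu : u ∈ grT3 F gr m) :
    Tfirst F u ∈ grT3 F gr m := by
  suffices h : grT3 F gr m ≤ (grT3 F gr m).comap (Tfirst F) from h hu
  refine iSup_le ?_
  rintro ⟨p, q⟩ _ ⟨x, rfl⟩
  simp only [Submodule.mem_comap]
  induction x with
  | zero => simp
  | add x y hx hy => simpa only [map_add] using add_mem hx hy
  | tmul x y =>
    induction y with
    | zero => simp
    | add y z hy hz => simpa only [TensorProduct.tmul_add, map_add] using add_mem hy hz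
    | tmul y z =>
      have hz : (z : V) ∈ gr (m - q - p) := by
        rw [show m - q - p = m - p - q by ring]
        exact z.2
      refine Submodule.mem_iSup_of_mem (q, p) ⟨y ⊗ₜ (x ⊗ₜ ⟨z, hz⟩), ?_⟩
      simp [Tfirst]

theorem GradedDual3.comp_Tfirst {f : V ⊗[F] (V ⊗[F] V) →ₗ[F] F} (hf : GradedDual3 F gr f) :
    GradedDual3 F gr (f ∘ₗ Tfirst F) := by
  obtain ⟨s, hs⟩ := hf
  exact ⟨s, fun m hm u hu => hs m hm _ (Tfirst_mem_grT3 hu)⟩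

theorem repr_collectedBasis_eq_zero (hgr : DirectSum.IsInternal gr) {ι : ℤ → Type*}
    (b : ∀ k, Module.Basis (ι k) F (gr k)) {k : ℤ} {v : V} (hv : v ∈ gr k) {i : Σ k, ι k}
    (hi : i.1 ≠ k) : (hgr.collectedBasis b).repr v i = 0 := by
  obtain ⟨l, i⟩ := i
  exact hgr.collectedBasis_repr_of_mem_ne b hi.symm hv

/-- The graded dual of `V^{⊗3}` separates points. -/
theorem eq_of_gradedDual3 (hgr : DirectSum.IsInternal gr) {u v : V ⊗[F] (V ⊗[F] V)}
    (h : ∀ f : V ⊗[F] (V ⊗[F] V) →ₗ[F] F, GradedDual3 F gr f → f u = f v) : u = v := by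
  let b := hgr.collectedBasis fun k => Module.Basis.ofVectorSpace F (gr k)
  let B := b.tensorProduct (b.tensorProduct b)
  refine B.ext_elem fun i => h (B.coord i) ⟨{i.1.1 + i.2.1.1 + i.2.2.1}, fun m hm w hw => ?_⟩
  suffices hle : grT3 F gr m ≤ LinearMap.ker (B.coord i) from hle hw
  refine iSup_le ?_
  rintro ⟨p, q⟩ _ ⟨x, rfl⟩
  rw [LinearMap.mem_ker]
  induction x with
  | zero => simp
  | add x y hx hy => rw [map_add, map_add, hx, hy, add_zero]
  | tmul x y =>
    induction y with
    | zero => simp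
    | add y z hy hz => rw [TensorProduct.tmul_add, map_add, map_add, hy, hz, add_zero]
    | tmul y z =>
      obtain ⟨i, j, k⟩ := i
      have e : B.coord (i, j, k) ((x : V) ⊗ₜ[F] ((y : V) ⊗ₜ[F] (z : V))) =
          b.repr x i * (b.repr y j * b.repr z k) := by
        simp [B, mul_comm]
      simp only [TensorProduct.map_tmul, Submodule.subtype_apply]
      rw [e]
      simp only [Finset.mem_singleton] at hm
      by_cases hi : i.1 = p
      · by_cases hj : j.1 = q
        · rw [show b.repr z k = 0 from repr_collectedBasis_eq_zero hgr _ z.2 (by omega)]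
          simp
        · rw [show b.repr y j = 0 from repr_collectedBasis_eq_zero hgr _ y.2 hj]
          simp
      · rw [show b.repr x i = 0 from repr_collectedBasis_eq_zero hgr _ x.2 hi]
        simp

end GradedDual

/-- If `(V, Y, c)` satisfies all the axioms of a graded vertex
coalgebra except possibly the Jacobi identity, and the conclusions of right
rationality, left rationality, cocommutativity and coassociativity hold for all
`v' ∈ (V^{⊗3})'` and `v ∈ V` (rendered coefficient-wise:
`⟨v',(Id⊗Y(x₂))Y(x₁)v⟩ = ι₁₂(g/(x₁^r x₂^s (x₁-x₂)^t))`, the same rational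
function expands via `ι₂₁` to `⟨v',(T⊗Id)(Id⊗Y(x₁))Y(x₂)v⟩`,
`⟨v',(Y(x₀)⊗Id)Y(x₂)v⟩ = ι₂₀(h/(x₀^r x₂^s (x₀+x₂)^t))`, and substituting
`x₀ = x₁ - x₂` in the latter rational function gives the former), then the
Jacobi identity holds, so `(V, Y, c)` is a graded vertex coalgebra. -/
theorem jacobi_from_rationality
    (Δ : ℤ → V →ₗ[F] V ⊗[F] V) (c : V →ₗ[F] F) (gr : ℤ → Submodule F V)
    (hsans : IsVertexCoalgSansJacobi F Δ c) (hgr : IsGradedVC F Δ gr)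
    (hcocom : ∀ (f : V ⊗[F] (V ⊗[F] V) →ₗ[F] F), GradedDual3 F gr f → ∀ v : V,
      (∃ N : ℤ, ∀ m n : ℤ,
        (N < m → f (comp12 F Δ (-m - 1) (-n - 1) v) = 0) ∧
        (n < -N → f (comp12 F Δ (-m - 1) (-n - 1) v) = 0)) ∧
      ∃ (g : ℤ → ℤ → F) (r s t : ℕ), IsPolyCoeff F g ∧
        (∀ m n : ℤ, mulPoly F r s t (-1)
          (fun m' n' => f (comp12 F Δ (-m' - 1) (-n' - 1) v)) m n = g m n) ∧
        (∀ m n : ℤ, mulPoly F r s t (-1)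
          (fun m' n' => f (Tfirst F (comp12 F Δ (-n' - 1) (-m' - 1) v))) m n = g m n))
    (hcoassoc : ∀ (f : V ⊗[F] (V ⊗[F] V) →ₗ[F] F), GradedDual3 F gr f → ∀ v : V,
      (∃ N : ℤ, ∀ m n : ℤ,
        (m < -N → f (compR F Δ Δ (-m - 1) (-n - 1) v) = 0) ∧
        (N < n → f (compR F Δ Δ (-m - 1) (-n - 1) v) = 0)) ∧
      ∃ (h : ℤ → ℤ → F) (r s t : ℕ), IsPolyCoeff F h ∧
        (∀ m n : ℤ, mulPoly F r s t 1
          (fun m' n' => f (compR F Δ Δ (-m' - 1) (-n' - 1) v)) m n = h m n) ∧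
        (∀ m n : ℤ, mulPoly F t s r (-1)
          (fun m' n' => f (comp12 F Δ (-m' - 1) (-n' - 1) v)) m n = substC F h m n)) :
    JacobiId F Δ Δ := by
  intro a b k w
  obtain ⟨N, hN⟩ := hsans.2.2.2.2 w
  have hfin : ∀ {E : Type} [AddCommGroup E] (φ : ℕ → E) (d : ℤ),
      (∀ i : ℕ, d - i < N → φ i = 0) → φ.support.Finite := by
    intro E _ φ d hφ
    refine (Set.finite_lt_nat (d - N + 1).toNat).subset fun i hi => ?_
    by_contra hlt
    simp only [Set.mem_ofPred_eq, not_lt] at hlt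
    exact hi (hφ i (by omega))
  have h12 : ∀ {m : ℤ} (n : ℤ), m < N → comp12 F Δ m n w = 0 := fun n hm => by
    simp [comp12, hN _ hm]
  have hR : ∀ {n : ℤ} (m : ℤ), n < N → compR F Δ Δ m n w = 0 := fun m hn => by
    simp [compR, hN _ hn]
  refine eq_of_gradedDual3 hgr.1 fun f hf => ?_
  obtain ⟨⟨N₁, hN₁⟩, g, r, s, t, -, hX, hY⟩ := hcocom f hf w
  obtain ⟨⟨N₂, hN₂⟩, -⟩ := hcocom _ hf.comp_Tfirst w
  obtain ⟨⟨N₃, hN₃⟩, h, r', s', t', hh, hZ, hXh⟩ := hcoassoc f hf w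
  have key := binomResidue_sub_eq F (X := fun m n => f (comp12 F Δ m n w))
    (Y := fun m n => f (Tfirst F (comp12 F Δ m n w))) (Z := fun m n => f (compR F Δ Δ m n w))
    (K₁ := N₁) (K₂ := N₂) (K₃ := N₃)
    (fun m n hn => by simpa using (hN₁ (-m - 1) (-n - 1)).2 (by omega))
    (fun m n hn => by simpa using (hN₂ (-m - 1) (-n - 1)).2 (by omega))
    (fun m n hm => by simpa using (hN₃ (-m - 1) (-n - 1)).1 (by omega))
    (fun m n => (hX m n).trans (hY m n).symm) hh hZ hXh a b k
  simp only [binomResidue, one_pow, one_mul] at key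
  rw [map_finsum f, map_finsum f]
  · simp only [map_smul, map_sub, smul_eq_mul]
    rw [← key, mul_finsum, ← finsum_sub_distrib]
    · exact finsum_congr fun i => by ring
    · exact hfin _ (a + b) fun i hi => by simp [h12 (k + i) hi]
    · exact hfin _ (a + k) fun i hi => by simp [h12 (b + i) hi]
  · exact hfin _ (b + k) fun i hi => by rw [hR _ hi, smul_zero]
  · refine hfin _ (max (a + b) (a + k)) fun i hi => ?_
    rw [h12 _ (by omega), h12 _ (by omega), map_zero, smul_zero, sub_zero, smul_zero]
end
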